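/- For every integer ℓ ≥ 1, with N = 2ℓ, the number of permutations σ of {0,…,2ℓ−1} for which the composite g = σ ∘ f is not topologically mixing is strictly greater than (3/8)·(2ℓ)!. In particular, the proportion of non-mixing permutations is bounded away from 0 as ℓ → ∞. -/

import Mathlib

open Set

noncomputable def fract01 (y : ℝ) : Set.Ico (0:ℝ) 1 :=
  ⟨Int.fract y, Int.fract_nonneg y, Int.fract_lt_one y⟩

/-- The map `f(x) = m x mod 1` on `[0,1)`. -/
noncomputable def mulMap (m : ℕ) (x : Set.Ico (0:ℝ) 1) : Set.Ico (0:ℝ) 1 :=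
  fract01 (m * x.val)

/-- The interval exchange map on `[0,1)` induced by a permutation `σ` of `ℤ/Nℤ`,
permuting the `N` subintervals `I_j = [j/N, (j+1)/N)`. -/
noncomputable def permMap (N : ℕ) (σ : Equiv.Perm (ZMod N)) (x : Set.Ico (0:ℝ) 1) :
    Set.Ico (0:ℝ) 1 :=
  fract01 (x.val +
    (((σ ((⌊(N : ℝ) * x.val⌋ : ℤ) : ZMod N)).val : ℝ) -
      (((⌊(N : ℝ) * x.val⌋ : ℤ) : ZMod N)).val) / N)

/-- Topological mixing of a self-map of a topological space. -/
def TopMixing {X : Type*} [TopologicalSpace X] (g : X → X) : Prop :=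
  ∀ U V : Set X, IsOpen U → IsOpen V → U.Nonempty → V.Nonempty →
    ∃ n₀ : ℕ, ∀ n ≥ n₀, (g^[n] '' U ∩ V).Nonempty

/-- The subinterval `I_j = [j/N, (j+1)/N)` of `[0,1)`. -/
def Isub (N : ℕ) (j : ZMod N) : Set (Set.Ico (0:ℝ) 1) :=
  {x | (j.val : ℝ) / N ≤ x.val ∧ x.val < ((j.val : ℝ) + 1) / N}

/-- `f̃(A) = {m·a + d : a ∈ A, 0 ≤ d ≤ m−1} ⊆ ℤ/Nℤ`. -/
def ftil (m N : ℕ) (A : Set (ZMod N)) : Set (ZMod N) :=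
  {b | ∃ a ∈ A, ∃ d : ℕ, d < m ∧ b = (m : ZMod N) * a + (d : ZMod N)}

/-- The Markov map `f(x) = 2x` on `[0,1/2)`, `f(x) = x − 1/2` on `[1/2,1)`. -/
noncomputable def subShiftMap (x : Set.Ico (0:ℝ) 1) : Set.Ico (0:ℝ) 1 :=
  if h : x.val < 1 / 2 then
    ⟨2 * x.val, ⟨by linarith [x.2.1], by linarith⟩⟩
  else
    ⟨x.val - 1 / 2, ⟨by linarith [not_lt.mp h], by linarith [x.2.2]⟩⟩

/-- `π` maps some nonempty subset of `H` into itself; for `π` on a finite type this says that some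
cycle of `π` is contained in `H`. -/
def HasCycleIn {α : Type*} (H : Set α) (π : Equiv.Perm α) : Prop :=
  ∃ S : Set α, S.Nonempty ∧ S ⊆ H ∧ ∀ x ∈ S, π x ∈ S

lemma HasCycleIn.decomposeFin_symm {n m : ℕ} {e : Equiv.Perm (Fin n)}
    (h : HasCycleIn {i : Fin n | i.val < m} e) (p : Fin (n + 1)) :
    HasCycleIn {i : Fin (n + 1) | i.val < m + 1} (Equiv.Perm.decomposeFin.symm (p, e)) := by
  obtain ⟨S, ⟨s, hs⟩, hSH, hS⟩ := h
  by_cases hp : ∃ x ∈ S, p = (e x).succ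
  · obtain ⟨x, hx, rfl⟩ := hp
    refine ⟨insert 0 (Fin.succ '' S), ⟨0, by simp⟩, ?_, ?_⟩
    · rintro _ (rfl | ⟨y, hy, rfl⟩)
      · simp
      · simpa using hSH hy
    · rintro _ (rfl | ⟨y, hy, rfl⟩)
      · simpa using hS x hx
      · rw [Equiv.Perm.decomposeFin_symm_apply_succ, Equiv.swap_apply_def]
        split_ifs
        · exact Or.inr ⟨e x, hS x hx, rfl⟩
        · exact Or.inl rfl
        · exact Or.inr ⟨e y, hS y hy, rfl⟩
  · push Not at hp
    refine ⟨Fin.succ '' S, ⟨_, s, hs, rfl⟩, ?_, ?_⟩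
    · rintro _ ⟨y, hy, rfl⟩
      simpa using hSH hy
    · rintro _ ⟨y, hy, rfl⟩
      rw [Equiv.Perm.decomposeFin_symm_apply_succ,
        Equiv.swap_apply_of_ne_of_ne (Fin.succ_ne_zero _) (hp y hy).symm]
      exact ⟨e y, hS y hy, rfl⟩

/-- The proportion of permutations of `Fin (l + m)` without a cycle among the first `m` elements
is at most `l / (l + m)`. -/
lemma ncard_not_hasCycleIn_mul_le (l m : ℕ) :
    {π : Equiv.Perm (Fin (l + m)) | ¬ HasCycleIn {i | i.val < m} π}.ncard * (l + m) ≤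
      l * (l + m).factorial := by
  induction m with
  | zero =>
    rw [mul_comm]
    refine Nat.mul_le_mul le_rfl ((Set.ncard_le_card _).trans_eq ?_)
    simp [Nat.card_eq_fintype_card, Fintype.card_perm]
  | succ m ih =>
    have key : {π : Equiv.Perm (Fin (l + m + 1)) | ¬ HasCycleIn {i | i.val < m + 1} π}.ncard ≤
        (({0}ᶜ : Set (Fin (l + m + 1))) ×ˢ
          {π : Equiv.Perm (Fin (l + m)) | ¬ HasCycleIn {i | i.val < m} π}).ncard := by
      refine Set.ncard_le_ncard_of_injOn Equiv.Perm.decomposeFin ?_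
        Equiv.Perm.decomposeFin.injective.injOn (Set.toFinite _)
      intro π hπ
      obtain ⟨⟨p, e⟩, rfl⟩ := Equiv.Perm.decomposeFin.symm.surjective π
      rw [Equiv.apply_symm_apply]
      refine ⟨?_, fun h => hπ (h.decomposeFin_symm p)⟩
      rintro rfl
      exact hπ ⟨{0}, by simp, by simp, by simp⟩
    rw [Set.ncard_prod, Set.ncard_compl, Set.ncard_singleton, Nat.card_eq_fintype_card,
      Fintype.card_fin, Nat.add_sub_cancel] at key
    calc _ ≤ _ * (l + m + 1) := Nat.mul_le_mul key le_rfl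
      _ = ({π : Equiv.Perm (Fin (l + m)) | ¬ HasCycleIn {i | i.val < m} π}.ncard * (l + m)) *
          (l + m + 1) := by ring
      _ ≤ l * (l + m).factorial * (l + m + 1) := Nat.mul_le_mul ih le_rfl
      _ = l * (l + (m + 1)).factorial := by
        rw [← add_assoc, Nat.factorial_succ]; ring

/-- On the right half of `[0,1)`, `σ ∘ f` translates `I_j` onto `I_{σ(j + ℓ)}`. -/
lemma permMap_subShiftMap_val {ℓ : ℕ} (hl : 1 ≤ ℓ) (σ : Equiv.Perm (ZMod (2 * ℓ)))
    (j : ZMod (2 * ℓ)) (hj : ℓ ≤ j.val) (t : ℝ) (ht0 : 0 ≤ t) (ht1 : t < 1)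
    (x : Set.Ico (0 : ℝ) 1) (hx : x.val = (j.val + t) / (2 * ℓ : ℕ)) :
    (permMap (2 * ℓ) σ (subShiftMap x)).val = ((σ (j + ℓ)).val + t) / (2 * ℓ : ℕ) := by
  have : NeZero (2 * ℓ) := ⟨by omega⟩
  have hl' : (0 : ℝ) < ℓ := by exact_mod_cast hl
  have hjl : (ℓ : ℝ) ≤ j.val := by exact_mod_cast hj
  have hN : (0 : ℝ) < (2 * ℓ : ℕ) := by push_cast; positivity
  have hhalf : ¬ x.val < 1 / 2 := by
    rw [hx, not_lt, div_le_div_iff₀ two_pos hN]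
    push_cast
    linarith
  have hs : (subShiftMap x).val = (((j.val - ℓ : ℕ) : ℝ) + t) / (2 * ℓ : ℕ) := by
    rw [subShiftMap, dif_neg hhalf]
    change x.val - 1 / 2 = _
    rw [hx]
    push_cast [hj]
    field_simp
    ring
  have hfl : ⌊((2 * ℓ : ℕ) : ℝ) * (subShiftMap x).val⌋ = ((j.val - ℓ : ℕ) : ℤ) := by
    rw [hs, mul_div_cancel₀ _ hN.ne', Int.floor_eq_iff]
    constructor <;> simp <;> linarith
  have hval : ((j.val - ℓ : ℕ) : ZMod (2 * ℓ)).val = j.val - ℓ :=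
    ZMod.val_cast_of_lt (lt_of_le_of_lt (Nat.sub_le _ _) j.val_lt)
  have hcast : ((j.val - ℓ : ℕ) : ZMod (2 * ℓ)) = j + ℓ := by
    have h2 : ((2 * ℓ : ℕ) : ZMod (2 * ℓ)) = 0 := ZMod.natCast_self _
    push_cast at h2
    rw [Nat.cast_sub hj, ZMod.natCast_zmod_val]
    linear_combination -h2
  rw [permMap, fract01, hfl, Int.cast_natCast, hval, hcast, hs]
  have hlt : ((σ (j + ℓ)).val : ℝ) + 1 ≤ (2 * ℓ : ℕ) := by exact_mod_cast (σ (j + ℓ)).val_lt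
  have heq : (((j.val - ℓ : ℕ) : ℝ) + t) / (2 * ℓ : ℕ) +
      (((σ (j + ℓ)).val : ℝ) - ((j.val - ℓ : ℕ) : ℝ)) / (2 * ℓ : ℕ) =
      ((σ (j + ℓ)).val + t) / (2 * ℓ : ℕ) := by
    ring
  rw [heq]
  exact Int.fract_eq_self.2 ⟨by positivity, by rw [div_lt_one hN]; linarith⟩

/-- If `j ↦ σ (j + ℓ)` has a cycle in `{j | ℓ ≤ j}`, then an iterate of `σ ∘ f` is the identity on
some `I_j`, so `σ ∘ f` is not mixing. -/
lemma not_topMixing_of_hasCycleIn {ℓ : ℕ} (hl : 1 ≤ ℓ) (σ : Equiv.Perm (ZMod (2 * ℓ)))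
    (h : HasCycleIn {j | ℓ ≤ j.val} (σ * Equiv.addRight (ℓ : ZMod (2 * ℓ)))) :
    ¬ TopMixing (fun x => permMap (2 * ℓ) σ (subShiftMap x)) := by
  have : NeZero (2 * ℓ) := ⟨by omega⟩
  obtain ⟨S, ⟨j, hjS⟩, hSH, hS⟩ := h
  set π := σ * Equiv.addRight (ℓ : ZMod (2 * ℓ))
  set g := fun x => permMap (2 * ℓ) σ (subShiftMap x)
  have hN : (0 : ℝ) < (2 * ℓ : ℕ) := by exact_mod_cast this.pos
  have hmem : ∀ n : ℕ, (π ^ n) j ∈ S := by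
    intro n
    induction n with
    | zero => simpa
    | succ n ih => rw [pow_succ']; exact hS _ ih
  have hiter : ∀ (x : Set.Ico (0 : ℝ) 1) (t : ℝ), 0 ≤ t → t < 1 →
      x.val = (j.val + t) / (2 * ℓ : ℕ) → ∀ n : ℕ,
      (g^[n] x).val = (((π ^ n) j).val + t) / (2 * ℓ : ℕ) := by
    intro x t ht0 ht1 hx n
    induction n with
    | zero => simpa using hx
    | succ n ih =>
      rw [Function.iterate_succ_apply', pow_succ']
      exact permMap_subShiftMap_val hl σ _ (hSH (hmem n)) t ht0 ht1 _ ih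
  have hjN : (j.val : ℝ) + 1 ≤ (2 * ℓ : ℕ) := by exact_mod_cast j.val_lt
  have hpt : ∀ t : ℝ, 0 ≤ t → t < 1 → (j.val + t) / (2 * ℓ : ℕ) ∈ Set.Ico (0 : ℝ) 1 :=
    fun t ht0 ht1 => ⟨by positivity, by rw [div_lt_one hN]; linarith⟩
  have hopen : ∀ a b : ℝ, IsOpen {x : Set.Ico (0 : ℝ) 1 |
      (2 * ℓ : ℕ) * x.val - j.val ∈ Set.Ioo a b} := fun a b =>
    isOpen_Ioo.preimage (by fun_prop)
  have hne : ∀ a b : ℝ, 0 ≤ a → a < b → b ≤ 1 → {x : Set.Ico (0 : ℝ) 1 |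
      (2 * ℓ : ℕ) * x.val - j.val ∈ Set.Ioo a b}.Nonempty := by
    intro a b ha hab hb
    refine ⟨⟨_, hpt ((a + b) / 2) (by linarith) (by linarith)⟩, ?_⟩
    rw [Set.mem_ofPred_eq, mul_div_cancel₀ _ hN.ne']
    constructor <;> linarith
  intro hmix
  obtain ⟨n₀, hn₀⟩ := hmix _ _ (hopen 0 (1 / 2)) (hopen (1 / 2) 1)
    (hne _ _ le_rfl (by norm_num) (by norm_num)) (hne _ _ (by norm_num) (by norm_num) le_rfl)
  obtain ⟨_, ⟨x, hxU, rfl⟩, hxV⟩ :=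
    hn₀ (orderOf π * n₀) (Nat.le_mul_of_pos_left _ (orderOf_pos π))
  have hfix : g^[orderOf π * n₀] x = x := by
    have hx : x.val = (j.val + ((2 * ℓ : ℕ) * x.val - j.val)) / (2 * ℓ : ℕ) := by
      field_simp
      ring
    refine Subtype.ext ?_
    rw [hiter x _ hxU.1.le (hxU.2.trans (by norm_num)) hx, pow_mul, pow_orderOf_eq_one, one_pow,
      Equiv.Perm.one_apply, ← hx]
  rw [hfix] at hxV
  exact lt_asymm hxU.2 hxV.1

lemma HasCycleIn.of_permCongr {α β : Type*} {H : Set β} (E : α ≃ β) {π : Equiv.Perm α}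
    (h : HasCycleIn H (E.permCongr π)) : HasCycleIn (E ⁻¹' H) π := by
  obtain ⟨S, ⟨s, hs⟩, hSH, hS⟩ := h
  exact ⟨E ⁻¹' S, ⟨E.symm s, by simpa⟩, Set.preimage_mono hSH,
    fun x hx => by simpa using hS _ hx⟩

/-- The rotation by `ℓ` identifies the upper half of `ZMod (2 * ℓ)` with the lower half of
`Fin (ℓ + ℓ)`. -/
lemma exists_equiv_fin_lt_iff {ℓ : ℕ} (hl : 1 ≤ ℓ) :
    ∃ E : ZMod (2 * ℓ) ≃ Fin (ℓ + ℓ), ∀ j, (E j).val < ℓ ↔ ℓ ≤ j.val := by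
  have : NeZero (2 * ℓ) := ⟨by omega⟩
  have hinj : Function.Injective (fun j : ZMod (2 * ℓ) =>
      (⟨(j + ℓ).val, two_mul ℓ ▸ (j + ℓ).val_lt⟩ : Fin (ℓ + ℓ))) := by
    intro a b hab
    exact add_right_cancel (ZMod.val_injective _ (Fin.mk.inj hab))
  refine ⟨Equiv.ofBijective _ ((Fintype.bijective_iff_injective_and_card _).2
    ⟨hinj, by simp [ZMod.card, two_mul]⟩), fun j => ?_⟩
  have hv : (ℓ : ZMod (2 * ℓ)).val = ℓ := ZMod.val_cast_of_lt (by omega)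
  have hj := j.val_lt
  simp only [Equiv.ofBijective_apply]
  rw [ZMod.val_add, hv]
  by_cases h : ℓ ≤ j.val
  · rw [Nat.mod_eq_sub_mod (by omega), Nat.mod_eq_of_lt (by omega)]
    omega
  · rw [Nat.mod_eq_of_lt (by omega)]
    omega

/-- for the map above and `N = 2ℓ`, more than `(3/8)·(2ℓ)!` permutations
`σ` give a non-mixing `σ ∘ f`. -/
theorem stmt14 (ℓ : ℕ) (hl : 1 ≤ ℓ) :
    (3 / 8 : ℝ) * ((2 * ℓ).factorial : ℝ) <
      ({σ : Equiv.Perm (ZMod (2 * ℓ)) |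
          ¬ TopMixing (fun x => permMap (2 * ℓ) σ (subShiftMap x))}.ncard : ℝ) := by
  have : NeZero (2 * ℓ) := ⟨by omega⟩
  obtain ⟨E, hE⟩ := exists_equiv_fin_lt_iff hl
  let Φ : Equiv.Perm (ZMod (2 * ℓ)) ≃ Equiv.Perm (Fin (ℓ + ℓ)) :=
    (Equiv.mulRight (Equiv.addRight (ℓ : ZMod (2 * ℓ)))).trans E.permCongr
  set B := {π : Equiv.Perm (Fin (ℓ + ℓ)) | ¬ HasCycleIn {i | i.val < ℓ} π} with hB
  have hsub : Φ.symm '' Bᶜ ⊆ {σ : Equiv.Perm (ZMod (2 * ℓ)) |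
      ¬ TopMixing (fun x => permMap (2 * ℓ) σ (subShiftMap x))} := by
    rintro _ ⟨π, hπ, rfl⟩
    refine not_topMixing_of_hasCycleIn hl _ ?_
    have hΦ : HasCycleIn {i : Fin (ℓ + ℓ) | i.val < ℓ} (Φ (Φ.symm π)) := by
      rw [Equiv.apply_symm_apply]
      exact not_not.1 hπ
    have := HasCycleIn.of_permCongr E hΦ
    simpa only [Set.preimage_ofPred_eq, hE, Equiv.coe_mulRight] using this
  have hle := Set.ncard_le_ncard hsub (Set.toFinite _)
  rw [Set.ncard_image_of_injective _ Φ.symm.injective] at hle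
  have hsum := Set.ncard_add_ncard_compl B
  rw [Nat.card_eq_fintype_card, Fintype.card_perm, Fintype.card_fin] at hsum
  have hbound := ncard_not_hasCycleIn_mul_le ℓ ℓ
  rw [← hB] at hbound
  have hhalf : 2 * B.ncard ≤ (ℓ + ℓ).factorial :=
    Nat.le_of_mul_le_mul_left (by linarith) hl
  have hfac : (ℓ + ℓ).factorial = (2 * ℓ).factorial := by rw [two_mul]
  have hpos := Nat.factorial_pos (2 * ℓ)
  have hlt : 3 * (2 * ℓ).factorial < 8 * {σ : Equiv.Perm (ZMod (2 * ℓ)) |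
      ¬ TopMixing (fun x => permMap (2 * ℓ) σ (subShiftMap x))}.ncard := by omega
  have hlt' : (3 : ℝ) * ((2 * ℓ).factorial : ℝ) < 8 * ({σ : Equiv.Perm (ZMod (2 * ℓ)) |
      ¬ TopMixing (fun x => permMap (2 * ℓ) σ (subShiftMap x))}.ncard : ℝ) := by
    exact_mod_cast hlt
  linarith
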